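/- arXiv:2409.08741 — 4 statements merged into one kernel-verified Lean document; each statement's English description precedes it below -/
import Mathlib

section
/- Let G be a group acting on a set X, let ρ : G → ℝ^{F×F} be an orthogonal matrix representation (ρ(gh) = ρ(g)ρ(h) and ρ(g)ᵀ ρ(g) = I for all g, h ∈ G), let σ : ℝ → ℝ be any function, let f̂ : X → ℝ^F satisfy f̂(g·x) = ρ(g) f̂(x), and let A : X → ℝ^{N×F} satisfy the equivariance constraint A(g·x) = A(x) ρ(g)ᵀ for all g ∈ G, x ∈ X. Then the adaptive activation layer T(x) := (1/N) A(x)ᵀ σ(A(x) f̂(x)), where σ is applied entrywise to the vector A(x) f̂(x), is exactly equivariant: T(g·x) = ρ(g) T(x) for all g ∈ G and x ∈ X. -/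
open Matrix

/-- If the sampling matrix `A` is generated equivariantly,
the adaptive activation layer `T x = (1/N) A(x)ᵀ σ(A(x) fhat(x))` is exactly
equivariant, regardless of the number `N` of samples. -/
theorem adaptive_activation_layer_equivariant
    {G X : Type*} [Group G] [MulAction G X] {F N : ℕ} (hN : 0 < N)
    (ρ : G → Matrix (Fin F) (Fin F) ℝ)
    (hρ_mul : ∀ g h : G, ρ (g * h) = ρ g * ρ h)
    (hρ_one : ρ 1 = 1)
    (hρ_orth : ∀ g : G, (ρ g)ᵀ * ρ g = 1)
    (σ : ℝ → ℝ)
    (fhat : X → Fin F → ℝ)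
    (hf : ∀ (g : G) (x : X), fhat (g • x) = (ρ g).mulVec (fhat x))
    (A : X → Matrix (Fin N) (Fin F) ℝ)
    (hA : ∀ (g : G) (x : X), A (g • x) = A x * (ρ g)ᵀ)
    (T : X → Fin F → ℝ)
    (hT : ∀ x : X,
      T x = (N : ℝ)⁻¹ • (A x)ᵀ.mulVec (fun i => σ (((A x).mulVec (fhat x)) i))) :
    ∀ (g : G) (x : X), T (g • x) = (ρ g).mulVec (T x) := by
  intro g x
  have h_preactivation : (A (g • x)).mulVec (fhat (g • x)) = (A x).mulVec (fhat x) := by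
    rw [hA, hf, mulVec_mulVec, Matrix.mul_assoc, hρ_orth, Matrix.mul_one]
  rw [hT, hT, h_preactivation, hA, transpose_mul, transpose_transpose, mulVec_smul,
    mulVec_mulVec]
end

section
/- Let G be a finite group, ρ : G → ℝ^{F×F} an orthogonal matrix representation (ρ(gh) = ρ(g)ρ(h) and ρ(g)ᵀ ρ(g) = I for all g, h ∈ G), δ ∈ ℝ^F a fixed vector, and σ : ℝ → ℝ any function. Define the fixed-grid activation layer sampling over the entire group, L(v) := (1/|G|) ∑_{g∈G} σ(⟨ρ(g)δ, v⟩) · ρ(g)δ for v ∈ ℝ^F, where ⟨·,·⟩ is the Euclidean inner product. Then L is exactly equivariant: L(ρ(g₀) v) = ρ(g₀) L(v) for every g₀ ∈ G and v ∈ ℝ^F. -/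
open Matrix

/-- The fixed-grid Fourier-based activation layer that samples
over the entire finite group, `L v = (1/|G|) ∑_g σ(⟨ρ(g)δ, v⟩) ρ(g)δ`, is
exactly equivariant. -/
theorem fixed_grid_activation_layer_equivariant
    {G : Type*} [Group G] [Fintype G] {F : ℕ}
    (ρ : G → Matrix (Fin F) (Fin F) ℝ)
    (hρ_mul : ∀ g h : G, ρ (g * h) = ρ g * ρ h)
    (hρ_one : ρ 1 = 1)
    (hρ_orth : ∀ g : G, (ρ g)ᵀ * ρ g = 1)
    (δ : Fin F → ℝ) (σ : ℝ → ℝ)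
    (L : (Fin F → ℝ) → Fin F → ℝ)
    (hL : ∀ v : Fin F → ℝ,
      L v = (Fintype.card G : ℝ)⁻¹ •
        ∑ g : G, σ (((ρ g).mulVec δ) ⬝ᵥ v) • ((ρ g).mulVec δ)) :
    ∀ (g₀ : G) (v : Fin F → ℝ), L ((ρ g₀).mulVec v) = (ρ g₀).mulVec (L v) := by
  intro g₀ v
  have dot_invariant (x : Fin F → ℝ) :
      (ρ g₀).mulVec x ⬝ᵥ (ρ g₀).mulVec v = x ⬝ᵥ v := by
    rw [dotProduct_mulVec, ← mulVec_transpose, mulVec_mulVec, hρ_orth, one_mulVec]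
  rw [hL, hL, mulVec_smul, mulVec_sum, ← Equiv.sum_comp (Equiv.mulLeft g₀)]
  simp only [Equiv.coe_mulLeft, hρ_mul, ← mulVec_mulVec, dot_invariant, mulVec_smul]
end

section
/- Let G be a finite group and let (ψ_i)_{i∈I} be a finite family of matrix representations ψ_i : G → ℂ^{d_i×d_i} such that: each ψ_i is unitary (ψ_i(g)* ψ_i(g) = I) and irreducible (only trivial invariant subspaces of ℂ^{d_i}); the ψ_i are pairwise non-isomorphic (for i ≠ j there is no invertible matrix S with ψ_i(g) S = S ψ_j(g) for all g ∈ G); and ∑_{i∈I} d_i² = |G|. Then the Fourier inversion formula holds: for every function f : G → ℂ and every g ∈ G, f(g) = ∑_{i∈I} d_i · Tr( f̂(ψ_i) · ψ_i(g)* ), where f̂(ψ_i) := (1/|G|) ∑_{u∈G} f(u) ψ_i(u). -/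
open Matrix

/-- **Schur's lemma** for matrices: an intertwiner between two irreducible families of matrices is
zero or invertible. -/
theorem Matrix.eq_zero_or_invertible_of_intertwines {K G m n : Type*} [Field K] [Fintype m]
    [Fintype n] [DecidableEq m] [DecidableEq n] {A : G → Matrix m m K} {B : G → Matrix n n K}
    (hA : ∀ U : Submodule K (m → K), (∀ g, ∀ v ∈ U, A g *ᵥ v ∈ U) → U = ⊥ ∨ U = ⊤)
    (hB : ∀ U : Submodule K (n → K), (∀ g, ∀ v ∈ U, B g *ᵥ v ∈ U) → U = ⊥ ∨ U = ⊤)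
    (M : Matrix m n K) (hM : ∀ g, A g * M = M * B g) :
    M = 0 ∨ ∃ T : Matrix n m K, M * T = 1 ∧ T * M = 1 := by
  have hker := hB (LinearMap.ker M.mulVecLin) fun g v hv => by
    simp only [LinearMap.mem_ker, mulVecLin_apply] at hv ⊢
    rw [mulVec_mulVec, ← hM g, ← mulVec_mulVec, hv, mulVec_zero]
  have hrange := hA (LinearMap.range M.mulVecLin) fun g v hv => by
    obtain ⟨w, rfl⟩ := hv
    exact ⟨B g *ᵥ w, by simp [mulVec_mulVec, hM g]⟩
  have zero_of (h : M.mulVecLin = 0) : M = 0 := by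
    rw [← toLin'_apply'] at h
    simpa using h
  rcases hker with hker | hker
  · rcases hrange with hrange | hrange
    · exact .inl (zero_of (LinearMap.range_eq_bot.mp hrange))
    · right
      let e := LinearEquiv.ofBijective M.mulVecLin
        ⟨LinearMap.ker_eq_bot.mp hker, LinearMap.range_eq_top.mp hrange⟩
      have he : (e : (n → K) →ₗ[K] m → K) = toLin' M := rfl
      refine ⟨LinearMap.toMatrix' (e.symm : (m → K) →ₗ[K] n → K), ?_, ?_⟩
      · apply (toLin' (R := K)).injective
        rw [toLin'_mul, toLin'_toMatrix', ← he, toLin'_one]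
        exact e.comp_symm
      · apply (toLin' (R := K)).injective
        rw [toLin'_mul, toLin'_toMatrix', ← he, toLin'_one]
        exact e.symm_comp
  · exact .inl (zero_of (LinearMap.ker_eq_top.mp hker))

/-- A matrix commuting with an irreducible family over an algebraically closed field is scalar. -/
theorem Matrix.exists_eq_smul_one_of_commutes {K G m : Type*} [Field K] [IsAlgClosed K]
    [Fintype m] [DecidableEq m] [Nonempty m] {A : G → Matrix m m K}
    (hA : ∀ U : Submodule K (m → K), (∀ g, ∀ v ∈ U, A g *ᵥ v ∈ U) → U = ⊥ ∨ U = ⊤)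
    (M : Matrix m m K) (hM : ∀ g, A g * M = M * A g) : ∃ c : K, M = c • 1 := by
  obtain ⟨c, hc⟩ := Module.End.exists_eigenvalue (toLin' M)
  obtain ⟨v, hv⟩ := hc.exists_hasEigenvector
  refine ⟨c, ?_⟩
  rcases eq_zero_or_invertible_of_intertwines hA hA (M - c • 1)
    (fun g => by simp [mul_sub, sub_mul, hM g]) with h | ⟨T, -, hT⟩
  · exact sub_eq_zero.mp h
  · refine absurd ?_ hv.2
    have hv' : (M - c • 1) *ᵥ v = 0 := by
      rw [sub_mulVec, smul_mulVec, one_mulVec, ← toLin'_apply, hv.apply_eq_smul, sub_self]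
    rw [← one_mulVec v, ← hT, ← mulVec_mulVec, hv', mulVec_zero]

/-- Averaging a matrix over two unitary matrix representations yields an intertwiner. -/
theorem Matrix.mul_sum_conjTranspose_intertwines {G m n : Type*} [Group G] [Fintype G]
    [Fintype m] [Fintype n] [DecidableEq n] {A : G → Matrix m m ℂ} {B : G → Matrix n n ℂ}
    (hA : ∀ g h, A (g * h) = A g * A h) (hB : ∀ g h, B (g * h) = B g * B h)
    (hBu : ∀ g, (B g)ᴴ * B g = 1) (X : Matrix m n ℂ) (h : G) :
    A h * ∑ g, A g * X * (B g)ᴴ = (∑ g, A g * X * (B g)ᴴ) * B h := by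
  rw [Matrix.mul_sum, Matrix.sum_mul,
    ← Equiv.sum_comp (Equiv.mulLeft h) fun g => A g * X * (B g)ᴴ * B h]
  refine Finset.sum_congr rfl fun g _ => ?_
  simp only [Equiv.coe_mulLeft, hA, hB, conjTranspose_mul, Matrix.mul_assoc, hBu, Matrix.mul_one]

theorem Matrix.mul_single_mul_conjTranspose_apply {m n : Type*} [Fintype m] [Fintype n]
    [DecidableEq m] [DecidableEq n] (A : Matrix m m ℂ) (B : Matrix n n ℂ) (a b : m) (c e : n) :
    (A * single b e (1 : ℂ) * Bᴴ) a c = A a b * star (B c e) := by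
  rw [Matrix.mul_apply, Finset.sum_eq_single e]
  · simp
  · intro x _ hx
    rw [mul_single_apply_of_ne _ _ _ _ _ hx, zero_mul]
  · simp

/-- Matrix coefficients of non-isomorphic irreducible unitary representations are orthogonal. -/
theorem Matrix.sum_coeff_mul_star_coeff_eq_zero {G m n : Type*} [Group G] [Fintype G]
    [Fintype m] [Fintype n] [DecidableEq m] [DecidableEq n]
    {A : G → Matrix m m ℂ} {B : G → Matrix n n ℂ}
    (hA : ∀ g h, A (g * h) = A g * A h) (hB : ∀ g h, B (g * h) = B g * B h)
    (hBu : ∀ g, (B g)ᴴ * B g = 1)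
    (hAi : ∀ U : Submodule ℂ (m → ℂ), (∀ g, ∀ v ∈ U, A g *ᵥ v ∈ U) → U = ⊥ ∨ U = ⊤)
    (hBi : ∀ U : Submodule ℂ (n → ℂ), (∀ g, ∀ v ∈ U, B g *ᵥ v ∈ U) → U = ⊥ ∨ U = ⊤)
    (hAB : ¬ ∃ S : Matrix m n ℂ, (∃ T : Matrix n m ℂ, S * T = 1 ∧ T * S = 1) ∧
      ∀ g, A g * S = S * B g) (a b : m) (c e : n) :
    ∑ g, A g a b * star (B g c e) = 0 := by
  have hM := mul_sum_conjTranspose_intertwines hA hB hBu (single b e 1)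
  rcases eq_zero_or_invertible_of_intertwines hAi hBi _ hM with h | h
  · simpa only [sum_apply, mul_single_mul_conjTranspose_apply, zero_apply]
      using congrFun (congrFun h a) c
  · exact absurd ⟨_, h, hM⟩ hAB

/-- Schur orthogonality for the matrix coefficients of an irreducible unitary representation. -/
theorem Matrix.card_mul_sum_coeff_mul_star_coeff {G m : Type*} [Group G] [Fintype G]
    [Fintype m] [DecidableEq m] {A : G → Matrix m m ℂ}
    (hA : ∀ g h, A (g * h) = A g * A h) (hAu : ∀ g, (A g)ᴴ * A g = 1)
    (hAi : ∀ U : Submodule ℂ (m → ℂ), (∀ g, ∀ v ∈ U, A g *ᵥ v ∈ U) → U = ⊥ ∨ U = ⊤)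
    (a b c e : m) :
    (Fintype.card m : ℂ) * ∑ g, A g a b * star (A g c e) =
      if a = c ∧ b = e then (Fintype.card G : ℂ) else 0 := by
  have : Nonempty m := ⟨a⟩
  obtain ⟨z, hz⟩ := exists_eq_smul_one_of_commutes hAi _
    (mul_sum_conjTranspose_intertwines hA hA hAu (single b e 1))
  have htr : (Fintype.card G : ℂ) * (if b = e then 1 else 0) = z * Fintype.card m := by
    have h := congrArg trace hz
    rw [trace_sum, trace_smul, trace_one, smul_eq_mul] at h
    rw [← h]
    have htrace (g : G) : (A g * single b e (1 : ℂ) * (A g)ᴴ).trace = if b = e then 1 else 0 := by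
      rw [trace_mul_comm, ← Matrix.mul_assoc, hAu, Matrix.one_mul]
      split_ifs with hbe
      · rw [hbe, trace_single_eq_same]
      · exact trace_single_eq_of_ne _ _ _ hbe
    simp [htrace]
  have hac := congrFun (congrFun hz a) c
  simp only [sum_apply, mul_single_mul_conjTranspose_apply, smul_apply, one_apply,
    smul_eq_mul] at hac
  rw [hac, ← mul_assoc, mul_comm _ z, ← htr]
  by_cases h₁ : a = c <;> by_cases h₂ : b = e <;> simp [h₁, h₂]

/-- **Fourier inversion.** Given a complete family of pairwise
non-isomorphic irreducible unitary matrix representations of a finite group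
`G` (so that `∑ dᵢ² = |G|`), every function `f : G → ℂ` is recovered from its
matrix Fourier coefficients:
`f(g) = ∑ᵢ dᵢ · Tr( f̂(ψᵢ) ψᵢ(g)* )`. -/
theorem fourier_inversion
    {G : Type*} [Group G] [Fintype G]
    {I : Type*} [Fintype I]
    (d : I → ℕ)
    (ψ : ∀ i : I, G → Matrix (Fin (d i)) (Fin (d i)) ℂ)
    (hψ_mul : ∀ i : I, ∀ g h : G, ψ i (g * h) = ψ i g * ψ i h)
    (hψ_one : ∀ i : I, ψ i 1 = 1)
    (hψ_unitary : ∀ (i : I) (g : G), (ψ i g)ᴴ * ψ i g = 1)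
    (hψ_irr : ∀ i : I, ∀ U : Submodule ℂ (Fin (d i) → ℂ),
      (∀ g : G, ∀ v ∈ U, (ψ i g).mulVec v ∈ U) → U = ⊥ ∨ U = ⊤)
    (h_noniso : ∀ i j : I, i ≠ j →
      ¬ ∃ S : Matrix (Fin (d i)) (Fin (d j)) ℂ,
        (∃ T : Matrix (Fin (d j)) (Fin (d i)) ℂ, S * T = 1 ∧ T * S = 1) ∧
        ∀ g : G, ψ i g * S = S * ψ j g)
    (h_complete : ∑ i : I, (d i) ^ 2 = Fintype.card G) :
    ∀ (f : G → ℂ) (g : G),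
      f g = ∑ i : I, (d i : ℂ) *
        (((Fintype.card G : ℂ)⁻¹ • ∑ u : G, f u • ψ i u) * (ψ i g)ᴴ).trace := by
  classical
  intro f g
  let K := Σ i : I, Fin (d i) × Fin (d i)
  have hcard : Fintype.card G = Fintype.card K := by
    simp [K, ← h_complete, sq]
  have hG : (Fintype.card G : ℂ) ≠ 0 := Nat.cast_ne_zero.mpr Fintype.card_ne_zero
  let A : Matrix G K ℂ := fun u k => ψ k.1 u k.2.1 k.2.2
  let B : Matrix K G ℂ := fun k u =>
    (Fintype.card G : ℂ)⁻¹ * d k.1 * star (ψ k.1 u k.2.1 k.2.2)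
  have hBA : B * A = 1 := by
    ext ⟨j, c, e⟩ ⟨i, a, b⟩
    have hsum : (B * A) ⟨j, c, e⟩ ⟨i, a, b⟩ =
        (Fintype.card G : ℂ)⁻¹ * (d j * ∑ u, ψ i u a b * star (ψ j u c e)) := by
      rw [Matrix.mul_apply, Finset.mul_sum, Finset.mul_sum]
      exact Finset.sum_congr rfl fun u _ => by simp only [A, B]; ring
    rw [hsum]
    by_cases hij : i = j
    · subst hij
      have h := card_mul_sum_coeff_mul_star_coeff (hψ_mul i) (hψ_unitary i) (hψ_irr i) a b c e
      rw [Fintype.card_fin] at h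
      rw [h, one_apply]
      by_cases hk : a = c ∧ b = e
      · obtain ⟨rfl, rfl⟩ := hk
        simp [hG]
      · have hk' : ¬ (c = a ∧ e = b) := fun h => hk ⟨h.1.symm, h.2.symm⟩
        simp [hk, hk']
    · rw [sum_coeff_mul_star_coeff_eq_zero (hψ_mul i) (hψ_mul j) (hψ_unitary j) (hψ_irr i)
        (hψ_irr j) (h_noniso i j hij), one_apply_ne fun h => hij (congrArg Sigma.fst h).symm]
      simp
  have hAB : A * B = 1 := (mul_eq_one_comm_of_card_eq G K ℂ hcard).mpr hBA
  have hterm (u : G) :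
      ∑ i, (d i : ℂ) * ((Fintype.card G : ℂ)⁻¹ * (ψ i u * (ψ i g)ᴴ).trace) = (A * B) u g := by
    rw [Matrix.mul_apply, Fintype.sum_sigma]
    simp only [A, B, Fintype.sum_prod_type, trace, Matrix.mul_apply,
      diag_apply, conjTranspose_apply, Finset.mul_sum]
    refine Finset.sum_congr rfl fun i _ => Finset.sum_congr rfl fun a _ =>
      Finset.sum_congr rfl fun b _ => by ring
  calc f g = ∑ u, f u * (A * B) u g := by simp [hAB, one_apply]
    _ = ∑ u, ∑ i, f u * ((d i : ℂ) *
          ((Fintype.card G : ℂ)⁻¹ * (ψ i u * (ψ i g)ᴴ).trace)) := by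
        simp only [← hterm, Finset.mul_sum]
    _ = _ := by
        rw [Finset.sum_comm]
        refine Finset.sum_congr rfl fun i _ => ?_
        simp only [Matrix.smul_mul, Matrix.sum_mul, trace_smul, trace_sum, smul_eq_mul,
          Finset.mul_sum]
        exact Finset.sum_congr rfl fun u _ => by ring
end

section
/- Let n ≥ 1, let R be an n×n real orthogonal matrix (Rᵀ R = I), let P be an invertible d_out × d_out real matrix and Q an invertible d_in × d_in real matrix, and let K : ℝⁿ → ℝ^{d_out × d_in} be a matrix-valued kernel satisfying the steerability constraint K(R x) = P · K(x) · Q⁻¹ for all x ∈ ℝⁿ. Let f : ℝⁿ → ℝ^{d_in} be such that for every x ∈ ℝⁿ the function y ↦ K(x − y) f(y) is Bochner integrable with respect to Lebesgue measure. Define the convolution (K ⋆ f)(x) := ∫_{ℝⁿ} K(x − y) f(y) dy and the transformed input (g·f)(x) := Q f(R⁻¹ x). Then the convolution is equivariant: (K ⋆ (g·f))(x) = P · (K ⋆ f)(R⁻¹ x) for all x ∈ ℝⁿ. -/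
open Matrix MeasureTheory

/-- Multiplication by a matrix of determinant `±1` preserves Lebesgue measure. -/
theorem Matrix.measurePreserving_mulVec_of_abs_det_eq_one {ι : Type*} [Fintype ι] [DecidableEq ι]
    {M : Matrix ι ι ℝ} (hM : |M.det| = 1) :
    MeasurePreserving (fun x : ι → ℝ => M *ᵥ x) volume volume := by
  have h0 : M.det ≠ 0 := by
    intro h
    simp [h] at hM
  refine ⟨(Matrix.mulVecLin M).continuous_of_finiteDimensional.measurable, ?_⟩
  have h := Real.map_matrix_volume_pi_eq_smul_volume_pi h0
  rw [abs_inv, hM, inv_one, ENNReal.ofReal_one, one_smul] at h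
  exact h

/-- Multiplication by an invertible real matrix is a measurable embedding. -/
theorem Matrix.measurableEmbedding_mulVec {ι : Type*} [Fintype ι] [DecidableEq ι]
    {M : Matrix ι ι ℝ} (hM : M.det ≠ 0) :
    MeasurableEmbedding (fun x : ι → ℝ => M *ᵥ x) :=
  (Matrix.mulVecLin M).continuous_of_finiteDimensional.measurableEmbedding
    (Matrix.mulVec_injective_of_isUnit ((Matrix.isUnit_iff_isUnit_det M).2 hM.isUnit))

/-- The determinant of an orthogonal real matrix has absolute value one. -/
theorem Matrix.abs_det_eq_one_of_transpose_mul_self {ι : Type*} [Fintype ι] [DecidableEq ι]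
    {R : Matrix ι ι ℝ} (hR : Rᵀ * R = 1) : |R.det| = 1 := by
  have h := congrArg Matrix.det hR
  rw [Matrix.det_mul, Matrix.det_transpose, Matrix.det_one] at h
  exact (abs_eq zero_le_one).2 (mul_self_eq_one_iff.1 h)

/-- Convolution with a `G`-steerable kernel is equivariant:
if `K(Rx) = P K(x) Q⁻¹` for an orthogonal matrix `R` and invertible input /
output representations `Q`, `P`, then `(K ⋆ (g·f))(x) = P (K ⋆ f)(R⁻¹ x)`,
where `(g·f)(x) = Q f(R⁻¹ x)`. -/
theorem steerable_convolution_equivariant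
    {n d_out d_in : ℕ} (hn : 1 ≤ n)
    (R : Matrix (Fin n) (Fin n) ℝ) (hR : Rᵀ * R = 1)
    (P : Matrix (Fin d_out) (Fin d_out) ℝ) (hP : IsUnit P)
    (Q : Matrix (Fin d_in) (Fin d_in) ℝ) (hQ : IsUnit Q)
    (K : (Fin n → ℝ) → Matrix (Fin d_out) (Fin d_in) ℝ)
    (hK : ∀ x : Fin n → ℝ, K (R.mulVec x) = P * K x * Q⁻¹)
    (f : (Fin n → ℝ) → Fin d_in → ℝ)
    (hf : ∀ x : Fin n → ℝ,
      Integrable (fun y : Fin n → ℝ => (K (x - y)).mulVec (f y)) volume) :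
    ∀ x : Fin n → ℝ,
      (∫ y : Fin n → ℝ, (K (x - y)).mulVec (Q.mulVec (f (R⁻¹.mulVec y))) ∂volume)
        = P.mulVec
            (∫ y : Fin n → ℝ, (K (R⁻¹.mulVec x - y)).mulVec (f y) ∂volume) := by
  intro x
  have hRdet := Matrix.abs_det_eq_one_of_transpose_mul_self hR
  have hRinv : R⁻¹ = Rᵀ := Matrix.inv_eq_left_inv hR
  have hSdet : |R⁻¹.det| = 1 := by rw [hRinv, Matrix.det_transpose, hRdet]
  have hS0 : R⁻¹.det ≠ 0 := by
    intro h
    simp [h] at hSdet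
  have hRR : R * R⁻¹ = 1 := by rw [hRinv]; exact mul_eq_one_comm.1 hR
  have hQQ : Q⁻¹ * Q = 1 := Matrix.nonsing_inv_mul Q ((Matrix.isUnit_iff_isUnit_det Q).1 hQ)
  have key (y : Fin n → ℝ) : (K (x - y)) *ᵥ (Q *ᵥ (f (R⁻¹ *ᵥ y))) =
      P *ᵥ ((K (R⁻¹ *ᵥ x - R⁻¹ *ᵥ y)) *ᵥ (f (R⁻¹ *ᵥ y))) := by
    have hxy : R *ᵥ (R⁻¹ *ᵥ x - R⁻¹ *ᵥ y) = x - y := by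
      rw [← Matrix.mulVec_sub, Matrix.mulVec_mulVec, hRR, Matrix.one_mulVec]
    rw [← hxy, hK, Matrix.mulVec_mulVec, Matrix.mulVec_mulVec, Matrix.mul_assoc, hQQ,
      Matrix.mul_one]
  simp_rw [key]
  rw [(Matrix.measurePreserving_mulVec_of_abs_det_eq_one hSdet).integral_comp
    (Matrix.measurableEmbedding_mulVec hS0)
    (fun z => P *ᵥ ((K (R⁻¹ *ᵥ x - z)) *ᵥ (f z)))]
  exact (LinearMap.toContinuousLinearMap (Matrix.mulVecLin P)).integral_comp_comm
    (hf (R⁻¹ *ᵥ x))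
end
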